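/- arXiv:1404.3348 — 2 statements merged into one kernel-verified Lean document; each statement's English description precedes it below -/
import Mathlib

section
/- (Quantum Local Orthogonality, N parties) For each party i ∈ {1,…,N} let d_i be a dimension, X_i a finite set of settings, Y_i a finite set of outcomes, and for each setting x_i ∈ X_i let {m^{(i,x_i)}_{y_i}}_{y_i∈Y_i} be a projective measurement on ℂ^{d_i} (Hermitian idempotent matrices summing to the identity). For an event e = (x, y) with x = (x_1,…,x_N) and y = (y_1,…,y_N), define the product effect P_e as the matrix on the index set ∏_i Fin d_i with entries P_e(a, b) = ∏_{i=1}^N m^{(i,x_i)}_{y_i}(a_i, b_i). Call two events e = (x,y) and e' = (x',y') locally orthogonal if there exists a party i with x_i = x'_i and y_i ≠ y'_i. Then for every density matrix ρ on the composite space (indexed by ∏_i Fin d_i) and every set O of pairwise locally orthogonal events, ∑_{e∈O} Tr(P_e * ρ) ≤ 1. -/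
open ComplexOrder

namespace Matrix

/-- The projections of a projective measurement are mutually orthogonal. -/
theorem mul_eq_zero_of_sum_eq_one {n κ : Type*} [Fintype n] [DecidableEq n] [Fintype κ]
    {p : κ → Matrix n n ℂ} (hherm : ∀ k, (p k).IsHermitian) (hidem : ∀ k, p k * p k = p k)
    (hsum : ∑ k, p k = 1) {j k : κ} (hjk : j ≠ k) : p j * p k = 0 := by
  classical
  have hsq (l : κ) : (p l * p k)ᴴ * (p l * p k) = p k * p l * p k := by
    rw [conjTranspose_mul, (hherm l).eq, (hherm k).eq, Matrix.mul_assoc, ← Matrix.mul_assoc (p l),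
      hidem, ← Matrix.mul_assoc]
  have htotal : ∑ l, (p l * p k)ᴴ * (p l * p k) = p k := by
    simp_rw [hsq]
    rw [← Finset.sum_mul, ← Finset.mul_sum, hsum, Matrix.mul_one, hidem]
  have hrest : ∑ l ∈ Finset.univ.erase k, (p l * p k)ᴴ * (p l * p k) = 0 := by
    rw [← Finset.add_sum_erase _ _ (Finset.mem_univ k), hsq k, hidem, hidem] at htotal
    simpa using htotal
  have htrace := congrArg trace hrest
  rw [trace_sum, trace_zero, Finset.sum_eq_zero_iff_of_nonneg
    fun l _ => (posSemidef_conjTranspose_mul_self _).trace_nonneg] at htrace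
  exact trace_conjTranspose_mul_self_eq_zero_iff.mp
    (htrace j (Finset.mem_erase.mpr ⟨hjk, Finset.mem_univ j⟩))

section PiTensor

variable {ι : Type*} [Fintype ι] {n : ι → Type*}

/-- The tensor product of a finite family of square matrices. -/
def piTensor (A : (i : ι) → Matrix (n i) (n i) ℂ) : Matrix ((i : ι) → n i) ((i : ι) → n i) ℂ :=
  of fun a b => ∏ i, A i (a i) (b i)

theorem piTensor_mul [DecidableEq ι] [∀ i, Fintype (n i)] (A B : (i : ι) → Matrix (n i) (n i) ℂ) :
    piTensor A * piTensor B = piTensor fun i => A i * B i := by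
  ext a b
  simp only [piTensor, mul_apply, of_apply, ← Finset.prod_mul_distrib]
  rw [Finset.prod_univ_sum, Fintype.piFinset_univ]

theorem IsHermitian.piTensor {A : (i : ι) → Matrix (n i) (n i) ℂ} (hA : ∀ i, (A i).IsHermitian) :
    (piTensor A).IsHermitian := by
  ext a b
  simp only [Matrix.piTensor, conjTranspose_apply, of_apply, star_prod]
  exact Finset.prod_congr rfl fun i _ => (hA i).apply (a i) (b i)

theorem piTensor_eq_zero {A : (i : ι) → Matrix (n i) (n i) ℂ} {i : ι} (hi : A i = 0) :
    piTensor A = 0 := by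
  ext a b
  exact Finset.prod_eq_zero (Finset.mem_univ i) (by rw [hi, zero_apply])

end PiTensor

/-- The weight that a Hermitian projection gives to a positive semidefinite matrix is at most its
trace. -/
theorem PosSemidef.trace_mul_le_of_isHermitian {n : Type*} [Fintype n] [DecidableEq n]
    {ρ Q : Matrix n n ℂ} (hρ : ρ.PosSemidef) (hQ : Q.IsHermitian) (hQQ : Q * Q = Q) :
    (Q * ρ).trace ≤ ρ.trace := by
  have hcompl : (1 - Q) * (1 - Q) = 1 - Q := IsIdempotentElem.one_sub hQQ
  have hnonneg := (hρ.mul_mul_conjTranspose_same (1 - Q)).trace_nonneg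
  rw [conjTranspose_sub, conjTranspose_one, hQ.eq, trace_mul_cycle, hcompl, Matrix.sub_mul,
    Matrix.one_mul, trace_sub] at hnonneg
  exact sub_nonneg.mp hnonneg

end Matrix

/-- Quantum Local Orthogonality for `N` parties: each party `i` has, for every setting
`x : X i`, a projective measurement `{m i x y}` on `ℂ^(d i)`.  For an event
`e = (x, y)` the product effect has entries `∏ i, m i (x i) (y i) (a i) (b i)`.
If `O` is a set of pairwise locally orthogonal events (some party has the same setting
but different outcomes), then for every density matrix `ρ` of the composite system the
probabilities of the events in `O` sum to at most `1`. -/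
theorem quantum_local_orthogonality {N : ℕ} (d : Fin N → ℕ)
    (X Y : Fin N → Type*) [∀ i, Fintype (X i)] [∀ i, Fintype (Y i)]
    (m : (i : Fin N) → X i → Y i → Matrix (Fin (d i)) (Fin (d i)) ℂ)
    (hherm : ∀ i x y, (m i x y).IsHermitian)
    (hidem : ∀ i x y, m i x y * m i x y = m i x y)
    (hsum : ∀ i x, ∑ y, m i x y = 1)
    (ρ : Matrix ((i : Fin N) → Fin (d i)) ((i : Fin N) → Fin (d i)) ℂ)
    (hρ : ρ.PosSemidef) (hρtr : ρ.trace = 1)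
    (O : Finset (((i : Fin N) → X i) × ((i : Fin N) → Y i)))
    (hLO : ∀ e ∈ O, ∀ e' ∈ O, e ≠ e' → ∃ i, e.1 i = e'.1 i ∧ e.2 i ≠ e'.2 i) :
    ∑ e ∈ O,
      ((Matrix.of (fun (a b : (i : Fin N) → Fin (d i)) => ∏ i, m i (e.1 i) (e.2 i) (a i) (b i)) * ρ).trace).re ≤ 1 := by
  classical
  let P (e : ((i : Fin N) → X i) × ((i : Fin N) → Y i)) :=
    Matrix.piTensor fun i => m i (e.1 i) (e.2 i)
  have hPherm (e) : (P e).IsHermitian := .piTensor fun i => hherm i _ _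
  have hPidem (e) : P e * P e = P e := by
    simp only [P, Matrix.piTensor_mul, hidem]
  have hPorth {e e'} (he : e ∈ O) (he' : e' ∈ O) (hne : e ≠ e') : P e * P e' = 0 := by
    obtain ⟨i, hx, hy⟩ := hLO e he e' he' hne
    rw [Matrix.piTensor_mul]
    refine Matrix.piTensor_eq_zero (i := i) ?_
    rw [hx]
    exact Matrix.mul_eq_zero_of_sum_eq_one (hherm i _) (hidem i _) (hsum i _) hy
  have hQherm : (∑ e ∈ O, P e).IsHermitian := by
    rw [Matrix.IsHermitian, Matrix.conjTranspose_sum]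
    exact Finset.sum_congr rfl fun e _ => hPherm e
  have hQidem : (∑ e ∈ O, P e) * ∑ e ∈ O, P e = ∑ e ∈ O, P e := by
    rw [Finset.sum_mul_sum]
    refine Finset.sum_congr rfl fun e he => ?_
    rw [Finset.sum_eq_single_of_mem e he fun e' he' hne => hPorth he he' hne.symm, hPidem]
  have hle := hρ.trace_mul_le_of_isHermitian hQherm hQidem
  rw [hρtr, Finset.sum_mul, Matrix.trace_sum] at hle
  have hre := (Complex.le_def.mp hle).1
  rw [Complex.re_sum, Complex.one_re] at hre
  exact hre
end

section
/- (Common Naimark dilation for finitely many POVMs) Let X be a finite set and for each x ∈ X let {m^{(x)}_y}_{y∈Y_x} be a POVM on ℂ^d. Then there exist a finite dimension n, a single density matrix σ on ℂ^n (independent of x), and for each x a projective measurement {M^{(x)}_y}_{y∈Y_x} on ℂ^d ⊗ ℂ^n (Hermitian idempotent (dn)×(dn) matrices summing to the identity, with the tensor product realized as the Kronecker product) such that Tr(m^{(x)}_y * ρ) = Tr(M^{(x)}_y * (ρ ⊗ σ)) for every d×d matrix ρ, every x ∈ X and every y ∈ Y_x. -/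
open ComplexOrder
open scoped Kronecker

open Matrix

section Naimark

variable {ι κ η : Type*} [Fintype ι] [DecidableEq ι] [DecidableEq κ]

open scoped MatrixOrder in
theorem Matrix.PosSemidef.exists_eq_conjTranspose_mul_self {A : Matrix ι ι ℂ}
    (hA : A.PosSemidef) : ∃ B : Matrix ι ι ℂ, A = Bᴴ * B :=
  CStarAlgebra.nonneg_iff_eq_star_mul_self.mp hA.nonneg

/-- Two isometries with orthogonal ranges are exchanged by a self-adjoint unitary. -/
theorem exists_isHermitian_unitary_swap {τ : Type*} [Fintype τ] [DecidableEq τ]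
    {V W : Matrix τ ι ℂ} (hV : Vᴴ * V = 1) (hW : Wᴴ * W = 1) (hVW : Vᴴ * W = 0) :
    ∃ U : Matrix τ τ ℂ, U.IsHermitian ∧ U * U = 1 ∧ U * W = V := by
  have hWV : Wᴴ * V = 0 := by
    simpa using congrArg conjTranspose hVW
  set U : Matrix τ τ ℂ := V * Wᴴ + W * Vᴴ + 1 - V * Vᴴ - W * Wᴴ with hU
  have hUW : U * W = V := by
    simp [hU, Matrix.add_mul, Matrix.sub_mul, Matrix.mul_assoc, hW, hVW]
  have hUV : U * V = W := by
    simp [hU, Matrix.add_mul, Matrix.sub_mul, Matrix.mul_assoc, hV, hWV]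
  refine ⟨U, ?_, ?_, hUW⟩
  · simp only [IsHermitian, hU, conjTranspose_add, conjTranspose_sub, conjTranspose_mul,
      conjTranspose_conjTranspose, conjTranspose_one]
    abel
  · have expand : U * U = U * V * Wᴴ + U * W * Vᴴ + U - U * V * Vᴴ - U * W * Wᴴ := by
      nth_rewrite 2 [hU]
      simp only [mul_add, mul_sub, mul_one, Matrix.mul_assoc]
    rw [expand, hUV, hUW, hU]
    abel

/-- The block column `∑ k, B k ⊗ |k⟩`. -/
def blockColumn (B : κ → Matrix ι ι ℂ) : Matrix (ι × κ) ι ℂ :=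
  Matrix.of fun p j => B p.2 p.1 j

theorem conjTranspose_blockColumn_mul_diagonal_mul [Fintype κ]
    (B C : κ → Matrix ι ι ℂ) (c : κ → ℂ) :
    (blockColumn B)ᴴ * (diagonal fun p : ι × κ => c p.2) * blockColumn C =
      ∑ k, c k • ((B k)ᴴ * C k) := by
  ext i j
  rw [Matrix.mul_apply]
  simp only [mul_diagonal]
  simp only [Matrix.mul_apply, Matrix.sum_apply, Matrix.smul_apply,
    Fintype.sum_prod_type_right, conjTranspose_apply, blockColumn, of_apply, smul_eq_mul,
    Finset.mul_sum]
  exact Finset.sum_congr rfl fun k _ => Finset.sum_congr rfl fun a _ => by ring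

theorem conjTranspose_blockColumn_mul [Fintype κ] (B C : κ → Matrix ι ι ℂ) :
    (blockColumn B)ᴴ * blockColumn C = ∑ k, (B k)ᴴ * C k := by
  simpa using conjTranspose_blockColumn_mul_diagonal_mul B C 1

theorem kronecker_single_eq_blockColumn (ρ : Matrix ι ι ℂ) (k₀ : κ) :
    ρ ⊗ₖ single k₀ k₀ (1 : ℂ) =
      blockColumn (Pi.single k₀ (1 : Matrix ι ι ℂ)) * ρ *
        (blockColumn (Pi.single k₀ (1 : Matrix ι ι ℂ)))ᴴ := by
  have entry (i j : ι) (k : κ) :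
      (blockColumn (Pi.single k₀ (1 : Matrix ι ι ℂ))) (i, k) j =
        if k₀ = k then (1 : Matrix ι ι ℂ) i j else 0 := by
    by_cases h : k₀ = k
    · subst h; simp [blockColumn]
    · simp [blockColumn, h, Ne.symm h]
  ext ⟨i, k⟩ ⟨j, l⟩
  simp only [kroneckerMap_apply, single_apply, Matrix.mul_apply, conjTranspose_apply, entry,
    Matrix.one_apply]
  rcases eq_or_ne k₀ k with rfl | hk <;> rcases eq_or_ne k₀ l with rfl | hl <;>
    simp [*, apply_ite]

/-- Naimark dilation of one POVM, with an ancilla prepared in the basis state `k₀`, as soon as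
the outcomes embed into the remaining basis states. -/
theorem exists_naimark_dilation [Fintype κ] [Fintype η] (m : η → Matrix ι ι ℂ)
    (hpos : ∀ y, (m y).PosSemidef) (hsum : ∑ y, m y = 1) {g : η → κ}
    (hg : Function.Injective g) {k₀ : κ} (hk₀ : ∀ y, g y ≠ k₀) :
    ∃ M : η → Matrix (ι × κ) (ι × κ) ℂ,
      (∀ y, (M y).IsHermitian) ∧ (∀ y, M y * M y = M y) ∧ ∑ y, M y = 1 ∧
      ∀ (ρ : Matrix ι ι ℂ) (y : η),
        (m y * ρ).trace = (M y * (ρ ⊗ₖ single k₀ k₀ (1 : ℂ))).trace := by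
  classical
  rcases isEmpty_or_nonempty η with hη | hη
  · have : IsEmpty ι := by
      by_contra h
      rw [not_isEmpty_iff] at h
      simp at hsum
    exact ⟨fun _ => 0, fun y => hη.elim y, fun y => hη.elim y, Subsingleton.elim _ _,
      fun _ y => hη.elim y⟩
  choose b hb using fun y => (hpos y).exists_eq_conjTranspose_mul_self
  set B : κ → Matrix ι ι ℂ := Function.extend g b 0 with hB
  have sum_extend (c : κ → ℂ) : ∑ k, c k • ((B k)ᴴ * B k) = ∑ y, c (g y) • m y := by
    refine (Fintype.sum_of_injective g hg _ _ (fun k hk => ?_) fun y => ?_).symm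
    · have : B k = 0 := Function.extend_apply' _ _ _ (by simpa using hk)
      simp [this]
    · rw [hB, hg.extend_apply, ← hb]
  have hV : (blockColumn B)ᴴ * blockColumn B = 1 := by
    rw [conjTranspose_blockColumn_mul, ← hsum]
    simpa using sum_extend 1
  set W := blockColumn (Pi.single k₀ (1 : Matrix ι ι ℂ)) with hWdef
  have hW : Wᴴ * W = 1 := by
    rw [hWdef, conjTranspose_blockColumn_mul, Fintype.sum_eq_single k₀] <;> simp +contextual
  have hVW : (blockColumn B)ᴴ * W = 0 := by
    have hBk₀ : B k₀ = 0 := Function.extend_apply' _ _ _ (by simpa using hk₀)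
    rw [hWdef, conjTranspose_blockColumn_mul, Fintype.sum_eq_single k₀] <;>
      simp +contextual [hBk₀]
  obtain ⟨U, hUH, hUU, hUW⟩ := exists_isHermitian_unitary_swap hV hW hVW
  let c (y : η) (k : κ) : ℂ := if Function.invFun g k = y then 1 else 0
  let P (y : η) : Matrix (ι × κ) (ι × κ) ℂ := diagonal fun p => c y p.2
  have hPH (y : η) : (P y)ᴴ = P y := by
    simp only [P, c, diagonal_conjTranspose]
    congr 1
    ext p
    simp [apply_ite]
  have hPP (y : η) : P y * P y = P y := by
    simp [P, c]
  have hPsum : ∑ y, P y = 1 := by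
    ext p q
    by_cases h : p = q <;>
      simp [Matrix.sum_apply, P, c, Matrix.one_apply, h]
  refine ⟨fun y => U * P y * U, fun y => ?_, fun y => ?_, ?_, fun ρ y => ?_⟩
  · simp only [IsHermitian, conjTranspose_mul, hPH, hUH.eq, Matrix.mul_assoc]
  · calc U * P y * U * (U * P y * U) = U * (P y * (U * U) * P y) * U := by
          simp only [Matrix.mul_assoc]
      _ = U * P y * U := by rw [hUU, mul_one, hPP]
  · rw [← Finset.sum_mul, ← Finset.mul_sum, hPsum, mul_one, hUU]
  · have hWU : Wᴴ * U = (blockColumn B)ᴴ := by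
      rw [← hUW, conjTranspose_mul, hUH.eq]
    have compress : Wᴴ * (U * P y * U) * W = m y := by
      calc Wᴴ * (U * P y * U) * W = Wᴴ * U * P y * (U * W) := by
            simp only [Matrix.mul_assoc]
        _ = m y := by
            rw [hWU, hUW, conjTranspose_blockColumn_mul_diagonal_mul, sum_extend]
            simp [c, Function.leftInverse_invFun hg _]
    rw [kronecker_single_eq_blockColumn, ← hWdef, ← compress,
      ← Matrix.mul_assoc (U * P y * U), Matrix.trace_mul_comm _ Wᴴ]
    simp only [Matrix.mul_assoc]

end Naimark

/-- Common Naimark dilation for finitely many POVMs: given a finite family of POVMs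
`{m x y}_{y : Y x}` on `ℂ^d` indexed by `x : X`, there exist a single ancilla dimension
`n`, a single density matrix `σ` on `ℂ^n`, and for each `x` a projective measurement
`{M x y}` on `ℂ^d ⊗ ℂ^n` such that `Tr(m x y * ρ) = Tr(M x y * (ρ ⊗ σ))` for every
state `ρ`, every `x` and every `y`. -/
theorem common_naimark_dilation {d : ℕ} {X : Type*} [Fintype X]
    (Y : X → Type*) [∀ x, Fintype (Y x)]
    (m : (x : X) → Y x → Matrix (Fin d) (Fin d) ℂ)
    (hpos : ∀ x y, (m x y).PosSemidef)
    (hsum : ∀ x, ∑ y, m x y = 1) :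
    ∃ (n : ℕ) (σ : Matrix (Fin n) (Fin n) ℂ)
      (M : (x : X) → Y x → Matrix (Fin d × Fin n) (Fin d × Fin n) ℂ),
      σ.PosSemidef ∧ σ.trace = 1 ∧
      (∀ x y, (M x y).IsHermitian) ∧
      (∀ x y, M x y * M x y = M x y) ∧
      (∀ x, ∑ y, M x y = 1) ∧
      (∀ (ρ : Matrix (Fin d) (Fin d) ℂ) (x : X) (y : Y x),
        (m x y * ρ).trace = (M x y * (ρ ⊗ₖ σ)).trace) := by
  classical
  let e := Fintype.equivFin (Option (Σ x, Y x))
  choose M hMH hMM hMsum hMtr using fun x =>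
    exists_naimark_dilation (m x) (hpos x) (hsum x)
      (g := fun y => e (some ⟨x, y⟩)) (k₀ := e none)
      (fun y y' h => by simpa using h) (fun y => by simp)
  refine ⟨_, single (e none) (e none) 1, M, ?_, by simp, hMH, hMM, hMsum,
    fun ρ x y => hMtr x ρ y⟩
  rw [← diagonal_single, posSemidef_diagonal_iff]
  intro k
  by_cases h : k = e none
  · subst h; simp
  · simp [h]
end
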